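/- Let λ be the cardinal defined by λ_0 = ℵ₀, λ_{n+1} = 2^{λ_n}, λ = sup_n λ_n. Let X be a real Banach space and Λ a set with |Λ| ≥ λ, and let (e_γ)_{γ∈Λ} be a normalized symmetric basis of X; that is: ‖e_γ‖ = 1 for all γ; for every x ∈ X there is a unique family of scalars (a_γ)_{γ∈Λ} such that the family (a_γ e_γ)_{γ∈Λ} is summable with sum x; and for every n, every pair of injective maps g, h : {1,…,n} → Λ and all scalars a_1, …, a_n, ‖Σ_{i=1}^n a_i e_{g(i)}‖ = ‖Σ_{i=1}^n a_i e_{h(i)}‖. If there exist a set Γ and a uniform embedding of X into c₀(Γ), then X is linearly isomorphic to c₀(Λ): there exists a continuous linear equivalence from X onto C₀(Λ, ℝ). -/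

import Mathlib

open Cardinal ZeroAtInfty

/-- The sequence `λ₀ = ℵ₀`, `λ_{n+1} = 2 ^ λ_n`. -/
def lamSeq : ℕ → Cardinal
  | 0 => ℵ₀
  | n + 1 => 2 ^ lamSeq n

/-- The cardinal `λ = sup_n λ_n`. -/
noncomputable def lam : Cardinal := ⨆ n, lamSeq n

open Filter Topology Function

theorem aleph0_le_lamSeq (n : ℕ) : ℵ₀ ≤ lamSeq n := by
  induction n with
  | zero => exact le_rfl
  | succ n ih => exact ih.trans (cantor _).le

theorem lamSeq_le_lam (n : ℕ) : lamSeq n ≤ lam :=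
  le_ciSup (bddAbove_of_small) n

/-- A polarized partition theorem: a countable colouring of a large enough finite power is constant
on a product of infinite sets. -/
theorem exists_injective_forall_eq (n : ℕ) : ∀ {Λ : Type*} (_ : lamSeq (2 * n) ≤ #Λ)
    (c : (Fin n → Λ) → ℕ), ∃ (B : Fin n → ℕ → Λ) (k : ℕ), (∀ i, Injective (B i)) ∧
      ∀ v : Fin n → ℕ, c (fun i => B i (v i)) = k := by
  induction n with
  | zero =>
    intro Λ _ c
    refine ⟨Fin.elim0, c Fin.elim0, fun i => i.elim0, fun v => ?_⟩
    congr 1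
    exact Subsingleton.elim _ _
  | succ n ih =>
    intro Λ hΛ c
    have hlt : lamSeq (2 * n) < lamSeq (2 * n + 1) := cantor _
    have hlt' : lamSeq (2 * n + 1) < lamSeq (2 * (n + 1)) := cantor _
    obtain ⟨M, hM⟩ := le_mk_iff_exists_set.1 ((hlt.trans hlt').le.trans hΛ)
    have hMinf : ℵ₀ ≤ #M := hM ▸ aleph0_le_lamSeq _
    have : Infinite M := infinite_iff.2 hMinf
    have : Infinite Λ := Infinite.of_injective _ (Subtype.val_injective (p := (· ∈ M)))
    let col : Λ → ((Fin n → M) → ℕ) := fun b a => c (Fin.cons b fun i => (a i : Λ))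
    have hcard : #((Fin n → M) → ℕ) < #Λ := by
      have h1 : #(Fin n → M) ≤ #M := by
        simpa using power_nat_le hMinf
      calc #((Fin n → M) → ℕ) = ℵ₀ ^ #(Fin n → M) := by simp
        _ ≤ ℵ₀ ^ #M := power_le_power_left aleph0_ne_zero h1
        _ = 2 ^ #M := by rw [power_eq_two_power hMinf (natCast_lt_aleph0 (n := 2)).le hMinf]
        _ = lamSeq (2 * n + 1) := by rw [hM]; rfl
        _ < #Λ := hlt'.trans_le hΛ
    obtain ⟨y, hy⟩ := exists_infinite_fiber col hcard
    obtain ⟨B, k, hB, hk⟩ := ih hM.ge y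
    let b := Infinite.natEmbedding (col ⁻¹' {y})
    refine ⟨Fin.cons (fun j => (b j : Λ)) fun i j => (B i j : Λ), k, ?_, fun v => ?_⟩
    · refine Fin.cases ?_ fun i => ?_
      · exact Subtype.val_injective.comp b.injective
      · exact Subtype.val_injective.comp (hB i)
    · have hy' : col (b (v 0)) = y := (b (v 0)).2
      refine Eq.trans ?_ ((congrFun hy' _).trans (hk fun i => v i.succ))
      refine congrArg c (funext fun i => ?_)
      refine Fin.cases ?_ (fun i => ?_) i <;> simp

/-- A map from `ℕⁿ` to `c₀(Γ)` that varies by at most `ε` when one coordinate changes, and whose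
values exceed `θ` at a bounded number of points, is close to an iterated limit `K` at arbitrarily
large points, except where both are small. -/
theorem exists_limit_of_update_close {Γ : Type*} {ε θ : ℝ} {k : ℕ} (n : ℕ) :
    ∀ (F : (Fin n → ℕ) → Γ → ℝ) (_ : ∀ v i b γ, |F v γ - F (update v i b) γ| ≤ ε)
      (_ : ∀ v (s : Finset Γ), (∀ γ ∈ s, θ < |F v γ|) → s.card ≤ k),
      ∃ K : Γ → ℝ, ∀ δ > 0, ∀ m, ∃ v, (∀ i, m ≤ v i) ∧
        ∀ γ, |F v γ - K γ| ≤ δ ∨ (|K γ| ≤ θ + δ ∧ |F v γ| ≤ θ + ε + δ) := by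
  induction n with
  | zero =>
    intro F _ _
    refine ⟨F Fin.elim0, fun δ hδ m => ⟨Fin.elim0, fun i => i.elim0, fun γ => ?_⟩⟩
    left
    simpa using hδ.le
  | succ n ih =>
    intro F hF hk
    let U : Ultrafilter ℕ := hyperfilter ℕ
    have hF0 (b b' : ℕ) (v : Fin n → ℕ) (γ : Γ) :
        |F (Fin.cons b v) γ - F (Fin.cons b' v) γ| ≤ ε := by
      simpa using hF (Fin.cons b v) 0 b' γ
    have hlim (v : Fin n → ℕ) (γ : Γ) :
        ∃ g, Tendsto (fun b => F (Fin.cons b v) γ) U (𝓝 g) := by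
      obtain ⟨g, -, hg⟩ := (isCompact_closedBall (F (Fin.cons 0 v) γ) ε).ultrafilter_le_nhds
        (U.map fun b => F (Fin.cons b v) γ)
        (le_principal_iff.2 (mem_map.2 (univ_mem' fun b => by
          simpa [Real.dist_eq] using hF0 b 0 v γ)))
      exact ⟨g, hg⟩
    choose G hG using hlim
    have hGF (b : ℕ) (v : Fin n → ℕ) (γ : Γ) : |F (Fin.cons b v) γ - G v γ| ≤ ε :=
      le_of_tendsto (tendsto_const_nhds.sub (hG v γ)).abs
        (Eventually.of_forall fun b' => hF0 b b' v γ)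
    have hGk (v : Fin n → ℕ) (s : Finset Γ) (hs : ∀ γ ∈ s, θ < |G v γ|) : s.card ≤ k := by
      have : ∀ᶠ b in (U : Filter ℕ), ∀ γ ∈ s, θ < |F (Fin.cons b v) γ| :=
        (eventually_all_finset s).2 fun γ hγ => (hG v γ).abs.eventually_const_lt (hs γ hγ)
      obtain ⟨b, hb⟩ := this.exists
      exact hk _ s hb
    obtain ⟨K, hK⟩ := ih G (fun v i b γ => by
      refine le_of_tendsto ((hG v γ).sub (hG (update v i b) γ)).abs
        (Eventually.of_forall fun b' => ?_)
      rw [Fin.cons_update]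
      exact hF _ _ _ _) hGk
    refine ⟨K, fun δ hδ m => ?_⟩
    obtain ⟨v, hv, hvK⟩ := hK (δ / 2) (half_pos hδ) m
    have hfin : {γ | θ < |G v γ|}.Finite := by
      by_contra hinf
      obtain ⟨s, hs, hcard⟩ := Set.Infinite.exists_subset_card_eq hinf (k + 1)
      have := hGk v s fun γ hγ => hs hγ
      omega
    have h1 : ∀ᶠ b in (U : Filter ℕ), ∀ γ ∈ {γ | θ < |G v γ|},
        |F (Fin.cons b v) γ - G v γ| < δ / 2 :=
      (eventually_all_finite hfin).2 fun γ _ => by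
        have := ((hG v γ).sub_const (G v γ)).abs
        rw [sub_self, abs_zero] at this
        exact this.eventually_lt_const (half_pos hδ)
    have h2 : ∀ᶠ b in (U : Filter ℕ), m ≤ b := Nat.hyperfilter_le_atTop (eventually_ge_atTop m)
    obtain ⟨b, hb, hbm⟩ := (h1.and h2).exists
    refine ⟨Fin.cons b v, Fin.cases hbm hv, fun γ => ?_⟩
    by_cases hγ : θ < |G v γ|
    · have := hb γ hγ
      rcases hvK γ with h | ⟨h, h'⟩
      · left; grind
      · right; grind
    · have := hGF b v γ
      right
      rcases hvK γ with h | ⟨h, h'⟩ <;> grind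

theorem norm_sum_smul_eq_of_injective {X : Type*} [NormedAddCommGroup X] [NormedSpace ℝ X]
    {Λ : Type*} {e : Λ → X}
    (h_symm : ∀ (n : ℕ) (g h : Fin n → Λ), Injective g → Injective h → ∀ a : Fin n → ℝ,
      ‖∑ i, a i • e (g i)‖ = ‖∑ i, a i • e (h i)‖)
    {ι : Type*} [Fintype ι] {g h : ι → Λ} (hg : Injective g) (hh : Injective h) (a : ι → ℝ) :
    ‖∑ i, a i • e (g i)‖ = ‖∑ i, a i • e (h i)‖ := by
  let E := (Fintype.equivFin ι).symm
  have := h_symm _ (g ∘ E) (h ∘ E) (hg.comp E.injective) (hh.comp E.injective) (a ∘ E)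
  simpa only [comp_apply, E.sum_comp fun i => a i • e (g i), E.sum_comp fun i => a i • e (h i)]
    using this

theorem norm_sum_smul_sub_eq_of_injective {X : Type*} [NormedAddCommGroup X] [NormedSpace ℝ X]
    {Λ : Type*} {e : Λ → X}
    (h_symm : ∀ (n : ℕ) (g h : Fin n → Λ), Injective g → Injective h → ∀ a : Fin n → ℝ,
      ‖∑ i, a i • e (g i)‖ = ‖∑ i, a i • e (h i)‖)
    {ι : Type*} [Fintype ι] {g h g' h' : ι → Λ} (hgh : Injective (Sum.elim g h))
    (hgh' : Injective (Sum.elim g' h')) (a : ι → ℝ) :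
    ‖∑ i, a i • (e (g i) - e (h i))‖ = ‖∑ i, a i • (e (g' i) - e (h' i))‖ := by
  have := norm_sum_smul_eq_of_injective h_symm hgh hgh' (Sum.elim a (-a))
  simpa [smul_sub, ← sub_eq_add_neg] using this

/-- A norm bound for the all-ones combination of differences extends to all coefficients in
`[-1, 1]`. -/
theorem norm_sum_smul_sub_le_of_abs_le_one {X : Type*} [NormedAddCommGroup X] [NormedSpace ℝ X]
    {Λ : Type*} {e : Λ → X} {C : ℝ} {ι : Type*} [Fintype ι]
    (hC : ∀ g h : ι → Λ, Injective (Sum.elim g h) → ‖∑ i, (e (g i) - e (h i))‖ ≤ C)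
    {g h : ι → Λ} (hgh : Injective (Sum.elim g h)) (a : ι → ℝ) (ha : ∀ i, |a i| ≤ 1) :
    ‖∑ i, a i • (e (g i) - e (h i))‖ ≤ C := by
  classical
  let T : (ι → ℝ) →ₗ[ℝ] X := Fintype.linearCombination ℝ fun i => e (g i) - e (h i)
  have hconv : Convex ℝ (T ⁻¹' Metric.closedBall 0 C) :=
    (convex_closedBall (0 : X) C).linear_preimage T
  have hsub : (Set.univ.pi fun _ : ι => ({-1, 1} : Set ℝ)) ⊆ T ⁻¹' Metric.closedBall 0 C := by
    intro s hs
    have hs' : ∀ i, s i = -1 ∨ s i = 1 := by simpa [Set.mem_pi] using hs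
    have hinj : Injective (Sum.elim (fun i => if s i = 1 then g i else h i)
        (fun i => if s i = 1 then h i else g i)) := by
      have hg : ∀ i j, g i = g j → i = j := fun i j hij => by
        simpa using @hgh (Sum.inl i) (Sum.inl j) hij
      have hh : ∀ i j, h i = h j → i = j := fun i j hij => by
        simpa using @hgh (Sum.inr i) (Sum.inr j) hij
      have hne : ∀ i j, g i ≠ h j := fun i j hij => by
        simpa using @hgh (Sum.inl i) (Sum.inr j) hij
      rintro (i | i) (j | j) hij <;> simp only [Sum.elim_inl, Sum.elim_inr] at hij <;> grind
    have := hC _ _ hinj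
    simp only [Set.mem_preimage, mem_closedBall_zero_iff]
    refine le_of_eq_of_le (congrArg norm ?_) this
    rw [Fintype.linearCombination_apply]
    refine Finset.sum_congr rfl fun i _ => ?_
    rcases hs' i with h | h
    · norm_num [h]
    · simp [h]
  have hmem : a ∈ convexHull ℝ (Set.univ.pi fun _ : ι => ({-1, 1} : Set ℝ)) := by
    rw [convexHull_pi]
    intro i _
    rw [convexHull_pair, segment_eq_Icc (by norm_num)]
    exact abs_le.1 (ha i)
  have := convexHull_min hsub hconv hmem
  simpa [T, Fintype.linearCombination_apply] using this

/-- If `X` embeds uniformly into `c₀(Γ)`, then the sums of differences of disjoint sets of basis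
vectors of the same size are bounded. -/
theorem exists_norm_sum_sub_le_of_isUniformEmbedding {X : Type*} [NormedAddCommGroup X]
    [NormedSpace ℝ X] {Λ : Type*} (hΛ : lam ≤ #Λ) {e : Λ → X} (h_norm : ∀ γ, ‖e γ‖ = 1)
    (h_symm : ∀ (n : ℕ) (g h : Fin n → Λ), Injective g → Injective h → ∀ a : Fin n → ℝ,
      ‖∑ i, a i • e (g i)‖ = ‖∑ i, a i • e (h i)‖)
    {Γ : Type*} [TopologicalSpace Γ] [DiscreteTopology Γ]
    {f : X → C₀(Γ, ℝ)} (hf : IsUniformEmbedding f) :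
    ∃ C : ℝ, ∀ (n : ℕ) (g h : Fin n → Λ), Injective (Sum.elim g h) →
      ‖∑ i, (e (g i) - e (h i))‖ ≤ C := by
  by_contra! hunb
  obtain ⟨-, huc, hinv⟩ := Metric.isUniformEmbedding_iff.1 hf
  obtain ⟨η, hη, hfη⟩ := hinv 1 one_pos
  obtain ⟨δ, hδ, hfδ⟩ := Metric.uniformContinuous_iff.1 huc (η / 8) (by positivity)
  obtain ⟨n, g, h, hgh, hbig⟩ := hunb (2 / δ)
  set N := ‖∑ i, (e (g i) - e (h i))‖ with hN
  have hNpos : 0 < N := lt_trans (by positivity) hbig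
  have hinfin : Infinite Λ := infinite_iff.2 ((lamSeq_le_lam 0).trans hΛ)
  obtain ⟨ι⟩ : Nonempty (ℕ × Λ ↪ Λ) := by
    have : #(ULift ℕ × Λ) ≤ #Λ := by simp [mk_prod]
    obtain ⟨ι⟩ := this
    exact ⟨(Equiv.prodCongr Equiv.ulift.symm (Equiv.refl Λ)).toEmbedding.trans ι⟩
  let x (a : Fin n → Λ) : X := N⁻¹ • ∑ i : Fin n, e (ι ((i : ℕ), a i))
  have hx (a : Fin n → Λ) (i : Fin n) (b : Λ) : dist (f (x a)) (f (x (update a i b))) < η / 8 := by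
    refine hfδ ?_
    have hsum : ∑ j : Fin n, e (ι ((j : ℕ), a j)) - ∑ j : Fin n, e (ι ((j : ℕ), update a i b j))
        = e (ι (i, a i)) - e (ι (i, b)) := by
      rw [← Finset.sum_sub_distrib, Finset.sum_eq_single i]
      · simp
      · intro j _ hj
        simp [hj]
      · simp
    rw [dist_eq_norm, ← smul_sub, hsum, norm_smul, norm_inv, Real.norm_of_nonneg hNpos.le]
    calc N⁻¹ * ‖e (ι (i, a i)) - e (ι (i, b))‖ ≤ N⁻¹ * 2 := by
          gcongr
          refine (norm_sub_le _ _).trans ?_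
          rw [h_norm, h_norm]; norm_num
      _ < δ := by
          rw [div_lt_iff₀ hδ] at hbig
          rw [inv_mul_lt_iff₀ hNpos]
          exact hbig
  have hfin (u : C₀(Γ, ℝ)) : {γ | η / 8 < |u γ|}.Finite := by
    have := zero_at_infty u
    rw [cocompact_eq_cofinite] at this
    have := this.abs.eventually_lt_const (u := η / 8) (by simpa using hη)
    exact Set.Finite.subset this fun γ (hγ : η / 8 < |u γ|) h => lt_asymm hγ h
  obtain ⟨B, k, hB, hk⟩ := exists_injective_forall_eq n ((lamSeq_le_lam _).trans hΛ)
    fun a => {γ | η / 8 < |f (x a) γ|}.ncard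
  have hle (u v : C₀(Γ, ℝ)) (γ : Γ) : |u γ - v γ| ≤ dist u v := by
    rw [← ZeroAtInftyContinuousMap.dist_toBCF_eq_dist, ← Real.dist_eq]
    exact BoundedContinuousFunction.dist_coe_le_dist (f := u.toBCF) (g := v.toBCF) γ
  obtain ⟨K, hK⟩ := exists_limit_of_update_close (θ := η / 8) (ε := η / 8) (k := k) n
    (fun v γ => f (x fun i => B i (v i)) γ)
    (fun v i b γ => by
      have heq : (fun j => B j (update v i b j)) = update (fun j => B j (v j)) i (B i b) := by
        ext j
        by_cases hj : j = i
        · subst hj; simp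
        · simp [hj]
      simp only [heq]
      exact (hle _ _ γ).trans (hx _ _ _).le)
    (fun v s hs => by
      rw [← hk v, ← Set.ncard_coe_finset]
      exact Set.ncard_le_ncard (fun γ hγ => hs γ hγ) (hfin _))
  obtain ⟨v, -, hv⟩ := hK (η / 32) (by positivity) 0
  obtain ⟨w, hvw, hw⟩ := hK (η / 32) (by positivity) (Finset.univ.sup v + 1)
  have hne (i : Fin n) : v i ≠ w i := by
    have := hvw i
    have := Finset.le_sup (f := v) (Finset.mem_univ i)
    omega
  have hdist : dist (f (x fun i => B i (v i))) (f (x fun i => B i (w i))) < η := by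
    rw [← ZeroAtInftyContinuousMap.dist_toBCF_eq_dist]
    refine lt_of_le_of_lt ((BoundedContinuousFunction.dist_le (C := 3 * η / 4)
      (by positivity)).2 fun γ => ?_) (by linarith)
    rw [Real.dist_eq]
    change |f (x fun i => B i (v i)) γ - f (x fun i => B i (w i)) γ| ≤ _
    rcases hv γ with h1 | ⟨h1, h1'⟩ <;> rcases hw γ with h2 | ⟨h2, h2'⟩ <;> grind
  refine absurd (hfη hdist) (not_lt.2 (le_of_eq ?_))
  have hinj : Injective (Sum.elim (fun i : Fin n => ι ((i : ℕ), B i (v i)))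
      (fun i : Fin n => ι ((i : ℕ), B i (w i)))) := by
    rintro (i | i) (j | j) hij <;>
      simp only [Sum.elim_inl, Sum.elim_inr, ι.injective.eq_iff, Prod.mk.injEq, Fin.val_inj] at hij
    · rw [hij.1]
    · obtain ⟨rfl, hij⟩ := hij
      exact absurd (hB i hij) (hne i)
    · obtain ⟨rfl, hij⟩ := hij
      exact absurd (hB i hij) (hne i).symm
    · rw [hij.1]
  have := norm_sum_smul_sub_eq_of_injective h_symm hgh hinj 1
  simp only [Pi.one_apply, one_smul] at this
  rw [dist_eq_norm, ← smul_sub, ← Finset.sum_sub_distrib, norm_smul, norm_inv,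
    Real.norm_of_nonneg hNpos.le, ← this, ← hN, inv_mul_cancel₀ hNpos.ne']

/-- The coefficient functionals of a symmetric basis are uniformly bounded. -/
theorem abs_mul_norm_sub_le_of_hasSum {X : Type*} [NormedAddCommGroup X] [NormedSpace ℝ X]
    {Λ : Type*} [Infinite Λ] {e : Λ → X}
    (h_symm : ∀ (n : ℕ) (g h : Fin n → Λ), Injective g → Injective h → ∀ a : Fin n → ℝ,
      ‖∑ i, a i • e (g i)‖ = ‖∑ i, a i • e (h i)‖)
    {p q : Λ} (hpq : p ≠ q) {a : Λ → ℝ} {x : X} (hx : HasSum (fun γ => a γ • e γ) x) (γ : Λ) :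
    |a γ| * ‖e p - e q‖ ≤ 2 * ‖x‖ := by
  classical
  refine ge_of_tendsto (hx.norm.const_mul 2) ?_
  filter_upwards [eventually_ge_atTop {γ}] with s hs
  have hγ : γ ∈ s := hs (Finset.mem_singleton_self γ)
  obtain ⟨γ', hγ'⟩ := Infinite.exists_notMem_finset s
  have hinj : Injective (update (Subtype.val : s → Λ) ⟨γ, hγ⟩ γ') := by
    intro i j hij
    rcases i with ⟨i, hi⟩
    rcases j with ⟨j, hj⟩
    simp only [update_apply] at hij
    grind
  have h1 := norm_sum_smul_eq_of_injective h_symm Subtype.val_injective hinj fun i : s => a i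
  have h2 : ∑ i : s, a i • e i - ∑ i : s, a i • e (update (Subtype.val : s → Λ) ⟨γ, hγ⟩ γ' i)
      = a γ • (e γ - e γ') := by
    rw [← Finset.sum_sub_distrib, Finset.sum_eq_single ⟨γ, hγ⟩]
    · simp [smul_sub]
    · intro j _ hj
      simp [hj]
    · simp
  have hne : γ ≠ γ' := fun h => hγ' (h ▸ hγ)
  have h3 : ‖e p - e q‖ = ‖e γ - e γ'‖ := by
    have hu : ∀ {r t : Λ}, r ≠ t → Injective (Sum.elim (fun _ : Unit => r) fun _ : Unit => t) := by
      rintro r t h (i | i) (j | j) hij <;> simp_all [eq_comm]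
    simpa using norm_sum_smul_sub_eq_of_injective h_symm (hu hpq) (hu hne) 1
  rw [h3, ← Real.norm_eq_abs, ← norm_smul, ← h2]
  refine (norm_sub_le _ _).trans (le_of_eq ?_)
  rw [← h1, ← two_mul, Finset.sum_coe_sort s fun i => a i • e i]

/-- Averaging over many disjoint copies: a bound on differences gives a bound on sums. -/
theorem norm_sum_smul_le_of_norm_sum_sub_le {X : Type*} [NormedAddCommGroup X] [NormedSpace ℝ X]
    [CompleteSpace X] {Λ : Type*} [Infinite Λ] {e : Λ → X}
    (h_basis : ∀ x : X, ∃! a : Λ → ℝ, HasSum (fun γ => a γ • e γ) x)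
    (h_symm : ∀ (n : ℕ) (g h : Fin n → Λ), Injective g → Injective h → ∀ a : Fin n → ℝ,
      ‖∑ i, a i • e (g i)‖ = ‖∑ i, a i • e (h i)‖)
    {C : ℝ} (hC : ∀ (n : ℕ) (g h : Fin n → Λ), Injective (Sum.elim g h) →
      ‖∑ i, (e (g i) - e (h i))‖ ≤ C)
    {ι : Type*} [Fintype ι] {g : ι → Λ} (hg : Injective g) (a : ι → ℝ) (ha : ∀ i, |a i| ≤ 1) :
    ‖∑ i, a i • e (g i)‖ ≤ C := by
  classical
  obtain ⟨p, q, hpq⟩ := exists_pair_ne Λ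
  have hd : 0 < ‖e p - e q‖ := by
    rw [norm_sub_pos_iff]
    intro h
    have hs (r : Λ) : HasSum (fun γ => (Pi.single r 1 : Λ → ℝ) γ • e γ) (e r) := by
      convert hasSum_single (f := fun γ => (Pi.single r 1 : Λ → ℝ) γ • e γ) r ?_ using 1
      · simp
      · intro γ hγ
        simp [hγ]
    have := (h_basis (e p)).unique (hs p) (h ▸ hs q)
    have := congrFun this p
    simp [hpq] at this
  obtain ⟨κ⟩ : Nonempty (Λ × ℕ ↪ Λ) := by
    have : #(Λ × ULift ℕ) ≤ #Λ := by simp [mk_prod]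
    obtain ⟨κ⟩ := this
    exact ⟨(Equiv.prodCongr (Equiv.refl Λ) Equiv.ulift.symm).toEmbedding.trans κ⟩
  let W (j : ℕ) : X := ∑ i, a i • e (κ (g i, j))
  let y (n : ℕ) : X := (1 / 2 : ℝ) ^ n • ∑ j ∈ Finset.range (2 ^ n), W j
  have hdist (n : ℕ) : dist (y n) (y (n + 1)) ≤ C / 2 / 2 ^ n := by
    have hinj : Injective (Sum.elim (fun r : Fin (2 ^ n) × ι => κ (g r.2, r.1))
        (fun r : Fin (2 ^ n) × ι => κ (g r.2, 2 ^ n + r.1))) := by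
      rintro (⟨j, i⟩ | ⟨j, i⟩) (⟨j', i'⟩ | ⟨j', i'⟩) h <;>
        simp only [Sum.elim_inl, Sum.elim_inr, κ.injective.eq_iff, Prod.mk.injEq,
          hg.eq_iff] at h <;> grind
    have hle := norm_sum_smul_sub_le_of_abs_le_one (fun g' h' hgh' => by
      let E := (Fintype.equivFin (Fin (2 ^ n) × ι)).symm
      have := hC _ (g' ∘ E) (h' ∘ E) (by
        rw [← Sum.elim_comp_map]
        exact hgh'.comp (E.injective.sumMap E.injective))
      simpa only [comp_apply, E.sum_comp fun i => e (g' i) - e (h' i)] using this) hinj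
      (fun r => a r.2) (fun r => ha r.2)
    have heq : y n - y (n + 1) = (1 / 2 : ℝ) ^ (n + 1) •
        ∑ r : Fin (2 ^ n) × ι, a r.2 • (e (κ (g r.2, r.1)) - e (κ (g r.2, 2 ^ n + r.1))) := by
      have h1 : ∑ r : Fin (2 ^ n) × ι, a r.2 • (e (κ (g r.2, r.1)) - e (κ (g r.2, 2 ^ n + r.1)))
          = ∑ j ∈ Finset.range (2 ^ n), W j - ∑ j ∈ Finset.range (2 ^ n), W (2 ^ n + j) := by
        rw [← Finset.sum_sub_distrib, Fintype.sum_prod_type,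
          ← Fin.sum_univ_eq_sum_range fun j => W j - W (2 ^ n + j)]
        simp only [W, smul_sub, Finset.sum_sub_distrib]
      have h2 : (1 / 2 : ℝ) ^ n = 2 * (1 / 2 : ℝ) ^ (n + 1) := by ring
      simp only [y]
      rw [h1, pow_succ 2 n, mul_two, Finset.sum_range_add, h2]
      module
    rw [dist_eq_norm, heq, norm_smul, Real.norm_of_nonneg (by positivity)]
    calc (1 / 2 : ℝ) ^ (n + 1) * _ ≤ (1 / 2 : ℝ) ^ (n + 1) * C := by gcongr
      _ = C / 2 / 2 ^ n := by rw [pow_succ, one_div_pow]; ring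
  obtain ⟨l, hl⟩ := cauchySeq_tendsto_of_complete (cauchySeq_of_le_geometric_two hdist)
  have hl0 : l = 0 := by
    obtain ⟨b, hb, -⟩ := h_basis l
    have hbound (γ : Λ) (n : ℕ) :
        |b γ| * ‖e p - e q‖ ≤ 2 * ‖l - y n‖ + (1 / 2) ^ n * ‖e p - e q‖ := by
      let G : Fin (2 ^ n) × ι → Λ := fun r => κ (g r.2, r.1)
      have hG : Injective G := by
        rintro ⟨j, i⟩ ⟨j', i'⟩ h
        simp only [G, κ.injective.eq_iff, Prod.mk.injEq, hg.eq_iff, Fin.val_inj] at h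
        rw [h.1, h.2]
      let c : Λ → ℝ := extend G (fun r => (1 / 2) ^ n * a r.2) 0
      have hc : |c γ| ≤ (1 / 2) ^ n := by
        by_cases h : ∃ r, G r = γ
        · obtain ⟨r, rfl⟩ := h
          simp only [c, hG.extend_apply, abs_mul]
          rw [abs_of_nonneg (by positivity)]
          exact mul_le_of_le_one_right (by positivity) (ha _)
        · simp only [c, extend_apply' _ _ _ h, Pi.zero_apply, abs_zero]
          positivity
      have hy : HasSum (fun γ => c γ • e γ) (y n) := by
        refine (hG.hasSum_iff fun γ hγ => ?_).1 ?_
        · simp [c, extend_apply' _ _ _ hγ]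
        · convert hasSum_fintype _ using 1
          simp only [y, W, comp_apply, c, hG.extend_apply, mul_smul, ← Finset.smul_sum]
          rw [Fintype.sum_prod_type, ← Fin.sum_univ_eq_sum_range fun j => ∑ i, a i • e (κ (g i, j))]
      have hsub : HasSum (fun γ => (b γ - c γ) • e γ) (l - y n) := by
        simpa only [sub_smul] using hb.sub hy
      have := abs_mul_norm_sub_le_of_hasSum h_symm hpq hsub γ
      calc |b γ| * ‖e p - e q‖ ≤ (|b γ - c γ| + |c γ|) * ‖e p - e q‖ := by
            gcongr
            simpa using abs_add_le (b γ - c γ) (c γ)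
        _ ≤ _ := by
            rw [add_mul]
            gcongr
    have hb0 (γ : Λ) : b γ = 0 := by
      have hlim : Tendsto (fun n => 2 * ‖l - y n‖ + (1 / 2 : ℝ) ^ n * ‖e p - e q‖) atTop
          (𝓝 (2 * ‖l - l‖ + 0 * ‖e p - e q‖)) :=
        ((tendsto_const_nhds.sub hl).norm.const_mul 2).add
          ((tendsto_pow_atTop_nhds_zero_of_lt_one (by norm_num) (by norm_num)).mul_const _)
      have := ge_of_tendsto' hlim (hbound γ)
      simp only [sub_self, norm_zero, mul_zero, zero_mul, add_zero] at this
      exact abs_nonpos_iff.1 (nonpos_of_mul_nonpos_left this hd)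
    simp only [hb0, zero_smul] at hb
    exact hb.unique hasSum_zero
  have := dist_le_of_le_geometric_two_of_tendsto₀ hdist hl
  have hκ : Injective fun i => κ (g i, 0) := fun i j h => by
    simpa [hg.eq_iff] using h
  rw [norm_sum_smul_eq_of_injective h_symm hg hκ]
  simpa [hl0, y, W] using this

theorem norm_finset_sum_smul_le {X : Type*} [NormedAddCommGroup X] [NormedSpace ℝ X]
    {Λ : Type*} {e : Λ → X} {C : ℝ}
    (hC : ∀ (s : Finset Λ) (a : Λ → ℝ), (∀ γ ∈ s, |a γ| ≤ 1) → ‖∑ γ ∈ s, a γ • e γ‖ ≤ C)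
    (s : Finset Λ) (a : Λ → ℝ) {M : ℝ} (hM : 0 ≤ M) (ha : ∀ γ ∈ s, |a γ| ≤ M) :
    ‖∑ γ ∈ s, a γ • e γ‖ ≤ C * M := by
  rcases hM.eq_or_lt with rfl | hM
  · rw [Finset.sum_eq_zero fun γ hγ => by rw [abs_nonpos_iff.1 (ha γ hγ), zero_smul]]
    simp
  · have := hC s (fun γ => M⁻¹ * a γ) fun γ hγ => by
      rw [abs_mul, abs_of_pos (inv_pos.2 hM), inv_mul_le_iff₀ hM, mul_one]
      exact ha γ hγ
    simp only [mul_smul, ← Finset.smul_sum, norm_smul, norm_inv, Real.norm_of_nonneg hM.le] at this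
    rwa [inv_mul_le_iff₀ hM, mul_comm] at this

theorem nonempty_equiv_zeroAtInfty_of_norm_sum_le {X : Type*} [NormedAddCommGroup X]
    [NormedSpace ℝ X] [CompleteSpace X] {Λ : Type*} [TopologicalSpace Λ] [DiscreteTopology Λ]
    {e : Λ → X} (h_norm : ∀ γ, ‖e γ‖ = 1)
    (h_basis : ∀ x : X, ∃! a : Λ → ℝ, HasSum (fun γ => a γ • e γ) x) {C : ℝ}
    (hC : ∀ (s : Finset Λ) (a : Λ → ℝ), (∀ γ ∈ s, |a γ| ≤ 1) → ‖∑ γ ∈ s, a γ • e γ‖ ≤ C) :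
    Nonempty (X ≃L[ℝ] C₀(Λ, ℝ)) := by
  classical
  have hC0 : 0 ≤ C := by simpa using hC ∅ 0
  have hle (u : C₀(Λ, ℝ)) (γ : Λ) : |u γ| ≤ ‖u‖ := u.toBCF.norm_coe_le_norm γ
  have hsum (u : C₀(Λ, ℝ)) : Summable fun γ => u γ • e γ := by
    rw [summable_iff_vanishing_norm]
    intro ε hε
    have hu := zero_at_infty u
    rw [cocompact_eq_cofinite] at hu
    have hpos : 0 < ε / (C + 1) := by positivity
    have hu' := hu.abs.eventually_lt_const (u := ε / (C + 1)) (by simpa using hpos)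
    rw [eventually_cofinite] at hu'
    refine ⟨hu'.toFinset, fun t ht => ?_⟩
    refine (norm_finset_sum_smul_le hC t u hpos.le fun γ hγ => ?_).trans_lt ?_
    · by_contra h
      exact Finset.disjoint_left.1 ht hγ (by simpa using (not_le.1 h).le)
    · rw [mul_div_assoc', div_lt_iff₀ (by positivity)]
      linarith
  let T : C₀(Λ, ℝ) →ₗ[ℝ] X :=
    { toFun := fun u => ∑' γ, u γ • e γ
      map_add' := fun u v => by
        simp only [ZeroAtInftyContinuousMap.add_apply, add_smul]
        exact (hsum u).tsum_add (hsum v)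
      map_smul' := fun r u => by
        simp only [ZeroAtInftyContinuousMap.smul_apply, smul_assoc, RingHom.id_apply]
        exact (hsum u).tsum_const_smul r }
  have hT (u : C₀(Λ, ℝ)) : HasSum (fun γ => u γ • e γ) (T u) := (hsum u).hasSum
  let T' : C₀(Λ, ℝ) →L[ℝ] X := T.mkContinuous C fun u =>
    le_of_tendsto (hT u).norm (Eventually.of_forall fun s =>
      norm_finset_sum_smul_le hC s u (norm_nonneg u) fun γ _ => hle u γ)
  refine ⟨(ContinuousLinearEquiv.ofBijective T' ?_ ?_).symm⟩
  · rw [LinearMap.ker_eq_bot]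
    intro u v huv
    have huv : T u = T v := huv
    exact DFunLike.coe_injective ((h_basis (T u)).unique (hT u) (huv ▸ hT v))
  · rw [LinearMap.range_eq_top]
    intro x
    obtain ⟨a, ha, -⟩ := h_basis x
    have ha0 : Tendsto a (cocompact Λ) (𝓝 0) := by
      rw [cocompact_eq_cofinite, tendsto_zero_iff_norm_tendsto_zero]
      simpa [norm_smul, h_norm] using ha.summable.tendsto_cofinite_zero.norm
    exact ⟨⟨⟨a, continuous_of_discreteTopology⟩, ha0⟩, (hT _).unique ha⟩

theorem symmetric_case {X : Type*} [NormedAddCommGroup X] [NormedSpace ℝ X]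
    [CompleteSpace X] {Λ : Type*} [TopologicalSpace Λ] [DiscreteTopology Λ]
    (hΛ : lam ≤ #Λ) (e : Λ → X)
    (h_norm : ∀ γ, ‖e γ‖ = 1)
    (h_basis : ∀ x : X, ∃! a : Λ → ℝ, HasSum (fun γ => a γ • e γ) x)
    (h_symm : ∀ (n : ℕ) (g h : Fin n → Λ), Function.Injective g →
      Function.Injective h → ∀ a : Fin n → ℝ,
        ‖∑ i, a i • e (g i)‖ = ‖∑ i, a i • e (h i)‖)
    {Γ : Type*} [TopologicalSpace Γ] [DiscreteTopology Γ]
    (f : X → C₀(Γ, ℝ)) (hf : IsUniformEmbedding f) :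
    Nonempty (X ≃L[ℝ] C₀(Λ, ℝ)) := by
  obtain ⟨C, hC⟩ := exists_norm_sum_sub_le_of_isUniformEmbedding hΛ h_norm h_symm hf
  have : Infinite Λ := infinite_iff.2 ((lamSeq_le_lam 0).trans hΛ)
  refine nonempty_equiv_zeroAtInfty_of_norm_sum_le h_norm h_basis (C := C) fun s a ha => ?_
  rw [← Finset.sum_coe_sort]
  exact norm_sum_smul_le_of_norm_sum_sub_le h_basis h_symm hC Subtype.val_injective
    (fun i : s => a i) fun i => ha i i.2
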